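/- arXiv:2009.13152 — 3 statements merged into one kernel-verified Lean document; each statement's English description precedes it below -/
import Mathlib

section
/- Let (S, Σ, κ) be a stochastic transition system, let A, B ∈ Σ, and suppose there exists a real number p > 0 such that for every state s ∈ A, P_{δ_s}(F B) ≥ p. Then for every initial distribution μ on S, P_μ(G (S∖B) ∩ GF A) = 0; that is, almost surely, no run avoids B forever while visiting A infinitely often. -/
open MeasureTheory ProbabilityTheory Filter Set Topology

/-- Prepend one state to an infinite run. -/
def prep {S : Type*} (s : S) (ρ : ℕ → S) : ℕ → S
  | 0 => s
  | n + 1 => ρ n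

/-- Prepend a finite word to an infinite run. -/
def prepList {S : Type*} (l : List S) (ρ : ℕ → S) : ℕ → S := fun n =>
  if h : n < l.length then l.get ⟨n, h⟩ else ρ (n - l.length)

/-- `E` is a tail event: membership is not affected by changing a finite prefix. -/
def IsTailEvent {S : Type*} (E : Set (ℕ → S)) : Prop :=
  ∀ (l : List S) (ρ : ℕ → S), ρ ∈ E ↔ prepList l ρ ∈ E

/-- Cylinder `Cyl A n = {ρ | ρ k ∈ A k for all k < n}` (built from `A 0, …, A (n-1)`). -/
def Cyl {S : Type*} (A : ℕ → Set S) (n : ℕ) : Set (ℕ → S) := {ρ | ∀ k < n, ρ k ∈ A k}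

/-- Event `F B`: eventually reach `B`. -/
def FEv {S : Type*} (B : Set S) : Set (ℕ → S) := {ρ | ∃ n, ρ n ∈ B}

/-- Event `F^{≤ m} B`: reach `B` within `m` steps. -/
def FleEv {S : Type*} (m : ℕ) (B : Set S) : Set (ℕ → S) := {ρ | ∃ n ≤ m, ρ n ∈ B}

/-- Event `G B`: always in `B`. -/
def GEv {S : Type*} (B : Set S) : Set (ℕ → S) := {ρ | ∀ n, ρ n ∈ B}

/-- Event `GF B`: visit `B` infinitely often. -/
def GFEv {S : Type*} (B : Set S) : Set (ℕ → S) := {ρ | ∀ i, ∃ j ≥ i, ρ j ∈ B}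

/-- Event `FG B`: eventually always in `B`. -/
def FGEv {S : Type*} (B : Set S) : Set (ℕ → S) := {ρ | ∃ i, ∀ j ≥ i, ρ j ∈ B}

/-- Event `GF φ_𝒜`: the pattern `A 0, …, A n` occurs at infinitely many positions. -/
def GFPat {S : Type*} (A : ℕ → Set S) (n : ℕ) : Set (ℕ → S) :=
  {ρ | ∀ i, ∃ j ≥ i, ∀ k ≤ n, ρ (j + k) ∈ A k}

/-- Event `A U B`. -/
def UntilEv {S : Type*} (A B : Set S) : Set (ℕ → S) :=
  {ρ | ∃ n, ρ n ∈ B ∧ ∀ k < n, ρ k ∈ A}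

/-- Event `A U^{≤ m} B`. -/
def UntilLeEv {S : Type*} (m : ℕ) (A B : Set S) : Set (ℕ → S) :=
  {ρ | ∃ n ≤ m, ρ n ∈ B ∧ ∀ k < n, ρ k ∈ A}

/-- The filtration `F n`: σ-algebra generated by the cylinders of length `n`,
i.e., by the first `n` coordinates. -/
def cylFiltration (S : Type*) [MeasurableSpace S] (n : ℕ) : MeasurableSpace (ℕ → S) :=
  MeasurableSpace.comap (fun ρ (i : Fin n) => ρ i) inferInstance

/-- `P` is the family of path measures of the STS `(S, Σ, κ)` given by the
Ionescu–Tulcea construction: for every initial probability distribution `μ`,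
`P μ` is a probability measure on runs, and `P` satisfies the Markov property
(`s₀ ∼ μ`, and the rest of the run follows the chain started in `κ s₀`),
which uniquely characterizes the Ionescu–Tulcea path measures. -/
def IsPathMeasure {S : Type*} [MeasurableSpace S] (κ : Kernel S S)
    (P : Measure S → Measure (ℕ → S)) : Prop :=
  (∀ μ : Measure S, IsProbabilityMeasure μ → IsProbabilityMeasure (P μ)) ∧
  (∀ μ : Measure S, IsProbabilityMeasure μ →
    P μ = μ.bind fun s => (P (κ s)).map (prep s))

/-- `B̃`: the set of states from which `B` is reached with probability zero. -/
def Btilde {S : Type*} [MeasurableSpace S] (P : Measure S → Measure (ℕ → S)) (B : Set S) :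
    Set S := {s | P (Measure.dirac s) (FEv B) = 0}

/-- The STS with path measures `P` is decisive w.r.t. `B`. -/
def Decisive {S : Type*} [MeasurableSpace S] (P : Measure S → Measure (ℕ → S)) (B : Set S) :
    Prop := ∀ μ : Measure S, IsProbabilityMeasure μ → P μ (FEv B ∪ FEv (Btilde P B)) = 1

/-- `ν_{A₀,…,Aₙ}`: the distribution of the `n`-th state under `P ν` conditioned on
the cylinder `Cyl A (n+1)`. -/
noncomputable def condDist {S : Type*} [MeasurableSpace S]
    (P : Measure S → Measure (ℕ → S)) (ν : Measure S) (A : ℕ → Set S) (n : ℕ) : Measure S :=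
  (ProbabilityTheory.cond (P ν) (Cyl A (n + 1))).map fun ρ => ρ n

theorem measurable_prep {S : Type*} [MeasurableSpace S] (s : S) : Measurable (prep s) := by
  refine measurable_pi_lambda _ fun n => ?_
  cases n with
  | zero => exact measurable_const
  | succ n => exact measurable_pi_apply n

theorem measurableSet_GEv {S : Type*} [MeasurableSpace S] {B : Set S} (hB : MeasurableSet B) :
    MeasurableSet (GEv B) := by
  have : GEv B = ⋂ n, (fun ρ : ℕ → S => ρ n) ⁻¹' B := by ext; simp [GEv]
  rw [this]
  exact MeasurableSet.iInter fun n => measurable_pi_apply n hB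

theorem measurableSet_FEv {S : Type*} [MeasurableSpace S] {B : Set S} (hB : MeasurableSet B) :
    MeasurableSet (FEv B) := by
  have : FEv B = ⋃ n, (fun ρ : ℕ → S => ρ n) ⁻¹' B := by ext; simp [FEv]
  rw [this]
  exact MeasurableSet.iUnion fun n => measurable_pi_apply n hB

theorem measurableSet_GFEv {S : Type*} [MeasurableSpace S] {B : Set S} (hB : MeasurableSet B) :
    MeasurableSet (GFEv B) := by
  have : GFEv B = ⋂ i, ⋃ j ≥ i, (fun ρ : ℕ → S => ρ j) ⁻¹' B := by
    ext; simp [GFEv]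
  rw [this]
  exact MeasurableSet.iInter fun i => MeasurableSet.iUnion fun j =>
    MeasurableSet.iUnion fun _ => measurable_pi_apply j hB

theorem measurableSet_Cyl {S : Type*} [MeasurableSpace S] {A : ℕ → Set S}
    (hA : ∀ n, MeasurableSet (A n)) (n : ℕ) : MeasurableSet (Cyl A n) := by
  have : Cyl A n = ⋂ k, ⋂ (_ : k < n), (fun ρ : ℕ → S => ρ k) ⁻¹' A k := by ext; simp [Cyl]
  rw [this]
  exact MeasurableSet.iInter fun k => MeasurableSet.iInter fun _ => measurable_pi_apply k (hA k)

theorem prep_mem_GFEv_iff {S : Type*} {A : Set S} (s : S) (ρ : ℕ → S) :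
    prep s ρ ∈ GFEv A ↔ ρ ∈ GFEv A := by
  refine ⟨fun h i => ?_, fun h i => ?_⟩
  · obtain ⟨j, hj, hjA⟩ := h (i + 1)
    obtain ⟨j, rfl⟩ : ∃ k, j = k + 1 := ⟨j - 1, by omega⟩
    exact ⟨j, by omega, hjA⟩
  · obtain ⟨j, hj, hjA⟩ := h i
    exact ⟨j + 1, by omega, hjA⟩

theorem prep_mem_GEv_iff {S : Type*} {B : Set S} (s : S) (ρ : ℕ → S) :
    prep s ρ ∈ GEv B ↔ s ∈ B ∧ ρ ∈ GEv B := by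
  refine ⟨fun h => ⟨h 0, fun n => h (n + 1)⟩, fun h n => ?_⟩
  cases n with
  | zero => exact h.1
  | succ n => exact h.2 n

theorem prep_mem_Cyl_const_succ_iff {S : Type*} {B : Set S} (s : S) (ρ : ℕ → S) (n : ℕ) :
    prep s ρ ∈ Cyl (fun _ => B) (n + 1) ↔ s ∈ B ∧ ρ ∈ Cyl (fun _ => B) n := by
  refine ⟨fun h => ⟨h 0 (by omega), fun k hk => h (k + 1) (by omega)⟩, fun h k hk => ?_⟩
  cases k with
  | zero => exact h.1
  | succ k => exact h.2 k (by omega)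

namespace IsPathMeasure

variable {S : Type*} [MeasurableSpace S] {κ : Kernel S S} {P : Measure S → Measure (ℕ → S)}

/-- If the kernel of the Markov property were not a.e.-measurable, `P μ` would be the junk
value `0` of `Measure.bind`. -/
theorem aemeasurable (hP : IsPathMeasure κ P) (μ : Measure S) [IsProbabilityMeasure μ] :
    AEMeasurable (fun s => (P (κ s)).map (prep s)) μ := by
  by_contra h
  have := hP.1 μ inferInstance
  have h0 : P μ = 0 := by
    rw [hP.2 μ inferInstance, Measure.bind, Measure.map_of_not_aemeasurable h, Measure.join_zero]
  exact IsProbabilityMeasure.ne_zero (P μ) h0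

theorem apply_eq_lintegral (hP : IsPathMeasure κ P) (μ : Measure S) [IsProbabilityMeasure μ]
    {E : Set (ℕ → S)} (hE : MeasurableSet E) :
    P μ E = ∫⁻ s, P (κ s) (prep s ⁻¹' E) ∂μ := by
  conv_lhs => rw [hP.2 μ inferInstance, Measure.bind_apply hE (hP.aemeasurable μ)]
  exact lintegral_congr fun s => Measure.map_apply (measurable_prep s) hE

theorem dirac_apply (hP : IsPathMeasure κ P) (s : S) {E : Set (ℕ → S)} (hE : MeasurableSet E) :
    P (Measure.dirac s) E = P (κ s) (prep s ⁻¹' E) := by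
  have hm := hP.aemeasurable (Measure.dirac s)
  have heq : (P (κ s)).map (prep s) = hm.mk _ s := by
    obtain ⟨t, ht, htm, h0⟩ :=
      exists_measurable_superset_of_null (ae_iff.1 hm.ae_eq_mk)
    by_contra hne
    have hs : s ∈ t := ht hne
    rw [Measure.dirac_apply' s htm] at h0
    simp [hs] at h0
  rw [← Measure.map_apply (measurable_prep s) hE, heq]
  conv_lhs => rw [hP.2 _ inferInstance, Measure.bind_apply hE hm]
  rw [lintegral_congr_ae (hm.ae_eq_mk.mono fun x hx => congrArg (· E) hx)]
  exact lintegral_dirac' s ((Measure.measurable_coe hE).comp hm.measurable_mk)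

/-- A uniform bound on the probability of avoiding `B` forever while visiting `A` infinitely often
may be multiplied by the probability of avoiding `B` during the first `n` steps. -/
theorem avoid_inter_GFEv_le_mul_Cyl [IsMarkovKernel κ] (hP : IsPathMeasure κ P) {A B : Set S}
    (hA : MeasurableSet A) (hB : MeasurableSet B) {c : ENNReal} (hc : c ≠ ⊤)
    (hbound : ∀ μ : Measure S, IsProbabilityMeasure μ → P μ (GEv Bᶜ ∩ GFEv A) ≤ c) (n : ℕ)
    (μ : Measure S) [IsProbabilityMeasure μ] :
    P μ (GEv Bᶜ ∩ GFEv A) ≤ c * P μ (Cyl (fun _ => Bᶜ) n) := by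
  induction n generalizing μ with
  | zero =>
    have := hP.1 μ inferInstance
    have : Cyl (fun _ => Bᶜ) 0 = (univ : Set (ℕ → S)) := by ext; simp [Cyl]
    rw [this, measure_univ, mul_one]
    exact hbound μ inferInstance
  | succ n ih =>
    rw [hP.apply_eq_lintegral μ ((measurableSet_GEv hB.compl).inter (measurableSet_GFEv hA)),
      hP.apply_eq_lintegral μ (measurableSet_Cyl (fun _ => hB.compl) _),
      ← lintegral_const_mul' _ _ hc]
    refine lintegral_mono fun s => ?_
    by_cases hs : s ∈ B
    · have : prep s ⁻¹' (GEv Bᶜ ∩ GFEv A) = ∅ := by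
        ext ρ; simp [prep_mem_GEv_iff, hs]
      simp [this]
    · have h1 : prep s ⁻¹' (GEv Bᶜ ∩ GFEv A) = GEv Bᶜ ∩ GFEv A := by
        ext ρ; simp [prep_mem_GEv_iff, prep_mem_GFEv_iff, hs]
      have h2 : prep s ⁻¹' Cyl (fun _ => Bᶜ) (n + 1) = Cyl (fun _ => Bᶜ) n := by
        ext ρ; simp [prep_mem_Cyl_const_succ_iff, hs]
      simpa only [h1, h2] using ih (κ s)

theorem avoid_inter_GFEv_le_mul_GEv [IsMarkovKernel κ] (hP : IsPathMeasure κ P) {A B : Set S}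
    (hA : MeasurableSet A) (hB : MeasurableSet B) {c : ENNReal} (hc : c ≠ ⊤)
    (hbound : ∀ μ : Measure S, IsProbabilityMeasure μ → P μ (GEv Bᶜ ∩ GFEv A) ≤ c)
    (μ : Measure S) [IsProbabilityMeasure μ] :
    P μ (GEv Bᶜ ∩ GFEv A) ≤ c * P μ (GEv Bᶜ) := by
  have := hP.1 μ inferInstance
  have hG : GEv Bᶜ = ⋂ n, Cyl (fun _ => Bᶜ) n := by
    ext ρ
    simp only [GEv, Cyl, mem_iInter, mem_ofPred_eq]
    exact ⟨fun h _ k _ => h k, fun h n => h (n + 1) n (by omega)⟩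
  have hlim : Tendsto (fun n => P μ (Cyl (fun _ => Bᶜ) n)) atTop (𝓝 (P μ (GEv Bᶜ))) := by
    rw [hG]
    exact tendsto_measure_iInter_atTop
      (fun n => (measurableSet_Cyl (fun _ => hB.compl) n).nullMeasurableSet)
      (fun _ _ hmn _ hρ k hk => hρ k (hk.trans_le hmn)) ⟨0, measure_ne_top _ _⟩
  exact ge_of_tendsto' (ENNReal.Tendsto.const_mul hlim (Or.inr hc))
    fun n => hP.avoid_inter_GFEv_le_mul_Cyl hA hB hc hbound n μ

/-- A bound from every starting state in `A` on the probability of avoiding `B` forever while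
visiting `A` infinitely often holds from every initial distribution. -/
theorem avoid_inter_GFEv_le_of_dirac_le [IsMarkovKernel κ] (hP : IsPathMeasure κ P) {A B : Set S}
    (hA : MeasurableSet A) (hB : MeasurableSet B) {d : ENNReal}
    (hbound : ∀ s ∈ A, P (Measure.dirac s) (GEv Bᶜ ∩ GFEv A) ≤ d)
    (μ : Measure S) [IsProbabilityMeasure μ] :
    P μ (GEv Bᶜ ∩ GFEv A) ≤ d := by
  have hE := (measurableSet_GEv hB.compl).inter (measurableSet_GFEv hA)
  have hstep : ∀ n (μ : Measure S), IsProbabilityMeasure μ →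
      P μ ((GEv Bᶜ ∩ GFEv A) \ Cyl (fun _ => Aᶜ) n) ≤ d := by
    intro n
    induction n with
    | zero =>
      intro μ _
      have : Cyl (fun _ => Aᶜ) 0 = (univ : Set (ℕ → S)) := by ext; simp [Cyl]
      simp [this]
    | succ n ih =>
      intro μ _
      rw [hP.apply_eq_lintegral μ (hE.diff (measurableSet_Cyl (fun _ => hA.compl) _))]
      refine (lintegral_mono (g := fun _ => d) fun s => ?_).trans_eq (by simp)
      by_cases hs : s ∈ A
      · refine le_trans ?_ (hbound s hs)
        rw [hP.dirac_apply s hE]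
        exact measure_mono (preimage_mono sdiff_subset)
      · refine le_trans (measure_mono fun ρ hρ => ?_) (ih (κ s) inferInstance)
        obtain ⟨⟨hG, hGF⟩, hV⟩ := hρ
        exact ⟨⟨((prep_mem_GEv_iff s ρ).1 hG).2, (prep_mem_GFEv_iff s ρ).1 hGF⟩,
          fun h => hV ((prep_mem_Cyl_const_succ_iff s ρ n).2 ⟨hs, h⟩)⟩
  have hU : GEv Bᶜ ∩ GFEv A = ⋃ n, (GEv Bᶜ ∩ GFEv A) \ Cyl (fun _ => Aᶜ) n := by
    refine Subset.antisymm (fun ρ hρ => ?_) (iUnion_subset fun _ => sdiff_subset)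
    obtain ⟨j, -, hj⟩ := hρ.2 0
    exact mem_iUnion.2 ⟨j + 1, hρ, fun h => h j (by omega) hj⟩
  have hmono : Monotone fun n => (GEv Bᶜ ∩ GFEv A) \ Cyl (fun _ => Aᶜ) n :=
    fun _ _ hmn => sdiff_subset_sdiff_right fun _ hρ k hk => hρ k (hk.trans_le hmn)
  rw [hU, hmono.measure_iUnion]
  exact iSup_le fun n => hstep n μ inferInstance

end IsPathMeasure

/-- If every state of `A` reaches `B` with probability at least `p > 0`, then for every
initial distribution `μ`, almost surely no run avoids `B` forever while visiting `A`
infinitely often: `P_μ(G (S∖B) ∩ GF A) = 0`. -/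
theorem no_avoid_B_forever_while_GF_A
    {S : Type*} [MeasurableSpace S] (κ : Kernel S S) [IsMarkovKernel κ]
    (P : Measure S → Measure (ℕ → S)) (hP : IsPathMeasure κ P)
    (A B : Set S) (hA : MeasurableSet A) (hB : MeasurableSet B)
    (p : ℝ) (hp : 0 < p)
    (hreach : ∀ s ∈ A, ENNReal.ofReal p ≤ P (Measure.dirac s) (FEv B)) :
    ∀ μ : Measure S, IsProbabilityMeasure μ → P μ (GEv Bᶜ ∩ GFEv A) = 0 := by
  let c : ENNReal := ⨆ (μ : Measure S) (_ : IsProbabilityMeasure μ), P μ (GEv Bᶜ ∩ GFEv A)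
  have hle : ∀ μ : Measure S, IsProbabilityMeasure μ → P μ (GEv Bᶜ ∩ GFEv A) ≤ c :=
    fun μ hμ => le_iSup₂ (f := fun (μ : Measure S) (_ : IsProbabilityMeasure μ) =>
      P μ (GEv Bᶜ ∩ GFEv A)) μ hμ
  have hc : c ≠ ⊤ := ne_top_of_le_ne_top ENNReal.one_ne_top <| iSup₂_le fun μ hμ =>
    have := hP.1 μ hμ
    prob_le_one
  have hcompl : GEv Bᶜ = (FEv B)ᶜ := by ext; simp [GEv, FEv]
  have hdirac : ∀ s ∈ A, P (Measure.dirac s) (GEv Bᶜ ∩ GFEv A) ≤ c * (1 - ENNReal.ofReal p) := by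
    intro s hs
    have := hP.1 (Measure.dirac s) inferInstance
    refine (hP.avoid_inter_GFEv_le_mul_GEv hA hB hc hle _).trans ?_
    rw [hcompl, prob_compl_eq_one_sub (measurableSet_FEv hB)]
    gcongr
    exact hreach s hs
  have hcle : c ≤ c * (1 - ENNReal.ofReal p) :=
    iSup₂_le fun μ _ => hP.avoid_inter_GFEv_le_of_dirac_le hA hB hdirac μ
  have hlt : 1 - ENNReal.ofReal p < 1 :=
    ENNReal.sub_lt_self ENNReal.one_ne_top one_ne_zero (ENNReal.ofReal_pos.2 hp).ne'
  have hc0 : c = 0 := by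
    by_contra h0
    have := ENNReal.mul_lt_mul_right h0 hc hlt
    rw [mul_one] at this
    exact (hcle.trans_lt this).false
  exact fun μ hμ => le_zero_iff.1 (hc0 ▸ hle μ hμ)
end

section
/- Decisiveness via countable abstraction: let T₁ = (S₁, Σ₁, κ₁) be a stochastic transition system, let S₂ be a countable set with the discrete σ-algebra equipped with a Markov kernel κ₂ (a countable Markov chain T₂), and let α : S₁ → S₂ be a measurable map such that T₂ is an α-abstraction of T₁. Assume: (1) there is a finite set A₂ = {s₁,…,s_n} ⊆ S₂ that is an attractor for T₂ and such that A₁ = α⁻¹(A₂) is an attractor for T₁; and (2) for every α-closed set B ∈ Σ₁, there exist p > 0 and k ∈ ℕ such that for every 1 ≤ i ≤ n, either every distribution μ with μ(α⁻¹(s_i)) = 1 satisfies P^{T₁}_μ(F^{≤k} B) ≥ p, or every such μ satisfies P^{T₁}_μ(F B) = 0. Then T₁ is decisive with respect to every α-closed set. -/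
open MeasureTheory ProbabilityTheory Filter Set Topology

theorem lintegral_dirac_of_aemeasurable {S : Type*} [MeasurableSpace S] {a : S}
    {f : S → ENNReal} (hf : AEMeasurable f (Measure.dirac a)) :
    ∫⁻ s, f s ∂(Measure.dirac a) = f a := by
  have hfa : f a = hf.mk f a := by
    by_contra hne
    have h0 : Measure.dirac a {s | ¬ f s = hf.mk f s} = 0 := hf.ae_eq_mk
    have h1 := (Measure.le_dirac_apply (a := a) (s := {s | ¬ f s = hf.mk f s})).trans h0.le
    simp [Set.indicator_of_mem (show a ∈ {s | ¬ f s = hf.mk f s} from hne)] at h1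
  rw [lintegral_congr_ae hf.ae_eq_mk, lintegral_dirac' _ hf.measurable_mk, hfa]

theorem measurableSet_cyl_const {S : Type*} [MeasurableSpace S] {D : Set S}
    (hD : MeasurableSet D) (n : ℕ) : MeasurableSet (Cyl (fun _ => D) n) := by
  have : Cyl (fun _ => D) n = ⋂ k, ⋂ (_ : k < n), (fun ρ : ℕ → S => ρ k) ⁻¹' D := by
    ext ρ; simp [Cyl]
  rw [this]
  exact MeasurableSet.iInter fun k => MeasurableSet.iInter fun _ => measurable_pi_apply k hD

theorem gEv_eq_iInter_cyl {S : Type*} (D : Set S) : GEv D = ⋂ n, Cyl (fun _ => D) n := by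
  ext ρ
  simp only [GEv, Cyl, mem_ofPred_eq, mem_iInter]
  exact ⟨fun h n k _ => h k, fun h n => h (n + 1) n n.lt_succ_self⟩

theorem measurableSet_gEv {S : Type*} [MeasurableSpace S] {D : Set S}
    (hD : MeasurableSet D) : MeasurableSet (GEv D) := by
  rw [gEv_eq_iInter_cyl]
  exact MeasurableSet.iInter fun n => measurableSet_cyl_const hD n

theorem prep_preimage_gEv_of_mem {S : Type*} {D : Set S} {s : S} (hs : s ∈ D) :
    prep s ⁻¹' GEv D = GEv D := by
  ext ρ
  refine ⟨fun h n => h (n + 1), fun h n => ?_⟩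
  cases n with
  | zero => exact hs
  | succ n => exact h n

theorem prep_preimage_gEv_of_notMem {S : Type*} {D : Set S} {s : S} (hs : s ∉ D) :
    prep s ⁻¹' GEv D = ∅ :=
  eq_empty_of_forall_notMem fun _ h => hs (h 0)

theorem prep_preimage_cyl_succ_of_mem {S : Type*} {D : Set S} {s : S} (hs : s ∈ D) (n : ℕ) :
    prep s ⁻¹' Cyl (fun _ => D) (n + 1) = Cyl (fun _ => D) n := by
  ext ρ
  refine ⟨fun h k hk => h (k + 1) (by omega), fun h k hk => ?_⟩
  cases k with
  | zero => exact hs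
  | succ k => exact h k (by omega)

theorem fEv_compl {S : Type*} (D : Set S) : (FEv D)ᶜ = GEv Dᶜ := by
  ext ρ; simp [FEv, GEv]

theorem fleEv_compl {S : Type*} (n : ℕ) (D : Set S) :
    (FleEv n D)ᶜ = Cyl (fun _ => Dᶜ) (n + 1) := by
  ext ρ; simp [FleEv, Cyl]

namespace IsPathMeasure

variable {S : Type*} [MeasurableSpace S] {κ : Kernel S S} {P : Measure S → Measure (ℕ → S)}

/-- Markov property at a fixed time, as an upper bound for staying in `D` forever. -/
theorem gEv_le_cyl_mul [IsMarkovKernel κ] (hP : IsPathMeasure κ P) {D : Set S}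
    (hD : MeasurableSet D) {c : ENNReal} (hc : c ≠ ⊤)
    (hle : ∀ μ : Measure S, IsProbabilityMeasure μ → P μ (GEv D) ≤ c) (n : ℕ)
    (μ : Measure S) [IsProbabilityMeasure μ] :
    P μ (GEv D) ≤ P μ (Cyl (fun _ => D) n) * c := by
  induction n generalizing μ with
  | zero =>
    have := hP.1 μ inferInstance
    have h : Cyl (fun _ => D) 0 = univ := by ext ρ; simp [Cyl]
    simpa [h] using hle μ inferInstance
  | succ n ih =>
    rw [hP.apply_eq_lintegral μ (measurableSet_gEv hD),
      hP.apply_eq_lintegral μ (measurableSet_cyl_const hD _), ← lintegral_mul_const' _ _ hc]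
    refine lintegral_mono fun s => ?_
    by_cases hs : s ∈ D
    · simpa only [prep_preimage_gEv_of_mem hs, prep_preimage_cyl_succ_of_mem hs] using ih (κ s)
    · simp [prep_preimage_gEv_of_notMem hs]

/-- Splitting according to whether `A` is visited before time `n`. -/
theorem gEv_le_cyl_add [IsMarkovKernel κ] (hP : IsPathMeasure κ P) {D A : Set S}
    (hD : MeasurableSet D) (hA : MeasurableSet A) {c : ENNReal}
    (hle : ∀ s ∈ A, P (Measure.dirac s) (GEv D) ≤ c) (n : ℕ)
    (μ : Measure S) [IsProbabilityMeasure μ] :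
    P μ (GEv D) ≤ P μ (Cyl (fun _ => Aᶜ) n) + c := by
  induction n generalizing μ with
  | zero =>
    have := hP.1 μ inferInstance
    have h : Cyl (fun _ => Aᶜ) 0 = univ := by ext ρ; simp [Cyl]
    rw [h, measure_univ]
    exact prob_le_one.trans le_self_add
  | succ n ih =>
    have hconst : c = ∫⁻ _, c ∂μ := by simp
    rw [hP.apply_eq_lintegral μ (measurableSet_gEv hD),
      hP.apply_eq_lintegral μ (measurableSet_cyl_const hA.compl _)]
    nth_rw 1 [hconst]
    rw [← lintegral_add_right _ measurable_const]
    refine lintegral_mono fun s => ?_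
    by_cases hs : s ∈ A
    · have := hle s hs
      rw [hP.dirac_apply s (measurableSet_gEv hD)] at this
      exact this.trans le_add_self
    · have hsub : prep s ⁻¹' GEv D ⊆ GEv D := fun _ h m => h (m + 1)
      simp only [prep_preimage_cyl_succ_of_mem (D := Aᶜ) hs]
      exact (measure_mono hsub).trans (ih (κ s))

/-- The probability of staying in `D` forever is controlled by the states of an attractor. -/
theorem gEv_le_of_attractor [IsMarkovKernel κ] (hP : IsPathMeasure κ P) {D A : Set S}
    (hD : MeasurableSet D) (hA : MeasurableSet A) {c : ENNReal}
    (hattr : ∀ μ : Measure S, IsProbabilityMeasure μ → P μ (FEv A) = 1)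
    (hle : ∀ s ∈ A, P (Measure.dirac s) (GEv D) ≤ c)
    (μ : Measure S) [IsProbabilityMeasure μ] : P μ (GEv D) ≤ c := by
  have := hP.1 μ inferInstance
  have h0 : P μ (GEv Aᶜ) = 0 := by
    have hm : MeasurableSet (FEv A) := by
      rw [← compl_compl (FEv A), fEv_compl]
      exact (measurableSet_gEv hA.compl).compl
    rw [← fEv_compl, prob_compl_eq_zero_iff hm]
    exact hattr μ inferInstance
  have hlim : Tendsto (fun n => P μ (Cyl (fun _ => Aᶜ) n)) atTop (𝓝 0) := by
    rw [← h0, gEv_eq_iInter_cyl]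
    refine tendsto_measure_iInter_atTop
      (fun n => (measurableSet_cyl_const hA.compl n).nullMeasurableSet)
      (fun m n hmn ρ hρ k hk => hρ k (hk.trans_le hmn)) ⟨0, measure_ne_top _ _⟩
  have hlim' := hlim.add_const c
  rw [zero_add] at hlim'
  exact ge_of_tendsto' hlim' fun n => hP.gEv_le_cyl_add hD hA hle n μ

/-- If from every state of an attractor `D` is left within `n` steps with probability bounded
below, then `D` is left almost surely. -/
theorem gEv_eq_zero_of_attractor [IsMarkovKernel κ] (hP : IsPathMeasure κ P) {D A : Set S}
    (hD : MeasurableSet D) (hA : MeasurableSet A) {q : ENNReal} (hq : q < 1) (n : ℕ)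
    (hattr : ∀ μ : Measure S, IsProbabilityMeasure μ → P μ (FEv A) = 1)
    (hle : ∀ s ∈ A, P (Measure.dirac s) (Cyl (fun _ => D) n) ≤ q)
    (μ : Measure S) [IsProbabilityMeasure μ] : P μ (GEv D) = 0 := by
  set c : ENNReal := ⨆ (ν : Measure S) (_ : IsProbabilityMeasure ν), P ν (GEv D) with hcdef
  have hbound : ∀ ν : Measure S, IsProbabilityMeasure ν → P ν (GEv D) ≤ c := fun ν hν =>
    le_iSup₂ (f := fun (ν : Measure S) (_ : IsProbabilityMeasure ν) => P ν (GEv D)) ν hν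
  have hc1 : c ≤ 1 := iSup₂_le fun ν hν => by
    have := hP.1 ν hν
    exact prob_le_one
  have hc : c ≠ ⊤ := (hc1.trans_lt ENNReal.one_lt_top).ne
  have hcq : c ≤ q * c := iSup₂_le fun ν hν =>
    hP.gEv_le_of_attractor hD hA hattr (fun s hs =>
      (hP.gEv_le_cyl_mul hD hc hbound n _).trans (mul_le_mul_left (hle s hs) c)) ν
  have hc0 : c = 0 := by
    by_contra hne
    have := ENNReal.mul_lt_mul_left hne hc hq
    rw [one_mul] at this
    exact absurd hcq this.not_ge
  exact le_antisymm ((hbound μ inferInstance).trans hc0.le) zero_le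

end IsPathMeasure

/-- **Decisiveness via countable abstraction.** Let `T₁ = (S₁, Σ₁, κ₁)` be an STS,
`T₂ = (S₂, κ₂)` a countable Markov chain (on a countable set with the discrete
σ-algebra), and `α : S₁ → S₂` measurable such that `T₂` is an `α`-abstraction of `T₁`.
Assume (1) there is a finite set `A₂ ⊆ S₂` that is an attractor for `T₂` and such that
`α⁻¹(A₂)` is an attractor for `T₁`, and (2) for every `α`-closed `B ∈ Σ₁` there are
`p > 0` and `k ∈ ℕ` such that for every `s₂ ∈ A₂`, either every distribution concentrated
on `α⁻¹(s₂)` reaches `B` within `k` steps with probability `≥ p`, or every such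
distribution reaches `B` with probability `0`. Then `T₁` is decisive with respect to
every `α`-closed set. -/
theorem countable_abstraction_decisive
    {S₁ : Type*} [MeasurableSpace S₁] {S₂ : Type*} [MeasurableSpace S₂] [Countable S₂]
    (hdiscrete : ∀ T : Set S₂, MeasurableSet T)
    (κ₁ : Kernel S₁ S₁) [IsMarkovKernel κ₁] (κ₂ : Kernel S₂ S₂) [IsMarkovKernel κ₂]
    (P₁ : Measure S₁ → Measure (ℕ → S₁)) (hP₁ : IsPathMeasure κ₁ P₁)
    (P₂ : Measure S₂ → Measure (ℕ → S₂)) (hP₂ : IsPathMeasure κ₂ P₂)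
    (α : S₁ → S₂) (hα : Measurable α)
    (habs : ∀ (s : S₁) (T : Set S₂), 0 < κ₂ (α s) T ↔ 0 < κ₁ s (α ⁻¹' T))
    (A₂ : Set S₂) (hA₂fin : A₂.Finite)
    (hA₂attr : ∀ μ₂ : Measure S₂, IsProbabilityMeasure μ₂ → P₂ μ₂ (FEv A₂) = 1)
    (hA₁attr : ∀ μ₁ : Measure S₁, IsProbabilityMeasure μ₁ → P₁ μ₁ (FEv (α ⁻¹' A₂)) = 1)
    (h2 : ∀ B : Set S₁, MeasurableSet B → B = α ⁻¹' (α '' B) →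
      ∃ p : ℝ, 0 < p ∧ ∃ k : ℕ, ∀ s₂ ∈ A₂,
        (∀ μ : Measure S₁, IsProbabilityMeasure μ → μ (α ⁻¹' {s₂}) = 1 →
          ENNReal.ofReal p ≤ P₁ μ (FleEv k B)) ∨
        (∀ μ : Measure S₁, IsProbabilityMeasure μ → μ (α ⁻¹' {s₂}) = 1 →
          P₁ μ (FEv B) = 0)) :
    ∀ B : Set S₁, MeasurableSet B → B = α ⁻¹' (α '' B) → Decisive P₁ B := by
  intro B hB hBα μ hμ
  obtain ⟨p, hp, k, hk⟩ := h2 B hB hBα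
  have hdirac : ∀ s : S₁, Measure.dirac s (α ⁻¹' {α s}) = 1 := fun s => by
    rw [Measure.dirac_apply' _ (hα (hdiscrete _))]
    simp
  set C₂ : Set S₂ := {t | ∀ ν : Measure S₁, IsProbabilityMeasure ν → ν (α ⁻¹' {t}) = 1 →
    P₁ ν (FEv B) = 0}
  have hCB : α ⁻¹' C₂ ⊆ Btilde P₁ B := fun s hs => hs _ inferInstance (hdirac s)
  set D : Set S₁ := (B ∪ α ⁻¹' C₂)ᶜ with hDdef
  have hD : MeasurableSet D := (hB.union (hα (hdiscrete _))).compl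
  have hq : 1 - ENNReal.ofReal p < 1 :=
    ENNReal.sub_lt_self ENNReal.one_ne_top one_ne_zero (ENNReal.ofReal_pos.2 hp).ne'
  have hzero : P₁ μ (GEv D) = 0 := by
    refine hP₁.gEv_eq_zero_of_attractor hD (hα (hdiscrete A₂)) hq (k + 1) hA₁attr
      (fun s hs => ?_) μ
    have := hP₁.1 (Measure.dirac s) inferInstance
    rcases hk (α s) hs with h | h
    · have hsub : Cyl (fun _ => D) (k + 1) ⊆ (FleEv k B)ᶜ := by
        rw [fleEv_compl]
        exact fun ρ hρ j hj hjB => hρ j hj (Or.inl hjB)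
      have hm : MeasurableSet (FleEv k B) := by
        rw [← compl_compl (FleEv k B), fleEv_compl]
        exact (measurableSet_cyl_const hB.compl _).compl
      refine (measure_mono hsub).trans ?_
      rw [prob_compl_eq_one_sub hm]
      exact tsub_le_tsub_left (h _ inferInstance (hdirac s)) 1
    · have hsD : s ∉ D := fun hsD => hsD (Or.inr h)
      have hempty : prep s ⁻¹' Cyl (fun _ => D) (k + 1) = ∅ :=
        eq_empty_of_forall_notMem fun _ hρ => hsD (hρ 0 k.succ_pos)
      rw [hP₁.dirac_apply s (measurableSet_cyl_const hD _), hempty, measure_empty]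
      exact zero_le
  have := hP₁.1 μ hμ
  refine le_antisymm prob_le_one ?_
  have hone : P₁ μ (GEv D)ᶜ = 1 := (prob_compl_eq_one_iff (measurableSet_gEv hD)).2 hzero
  rw [← hone]
  refine measure_mono ?_
  rw [hDdef, ← fEv_compl, compl_compl]
  rintro ρ ⟨n, hn | hn⟩
  · exact Or.inl ⟨n, hn⟩
  · exact Or.inr ⟨n, hCB hn⟩
end

section
/- An attractor is almost surely visited infinitely often: let (S, Σ, κ) be a stochastic transition system and let A ∈ Σ be an attractor. Then for every initial distribution μ on S, P_μ(GF A) = 1. -/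
open MeasureTheory ProbabilityTheory Filter Set Topology

/-- The Markov property of the path measures, evaluated on a measurable event. -/
theorem IsPathMeasure.apply_eq_lintegral_s11 {S : Type*} [MeasurableSpace S] {κ : Kernel S S}
    {P : Measure S → Measure (ℕ → S)} (hP : IsPathMeasure κ P)
    (μ : Measure S) [hμ : IsProbabilityMeasure μ] {E : Set (ℕ → S)} (hE : MeasurableSet E) :
    P μ E = ∫⁻ s, P (κ s) (prep s ⁻¹' E) ∂μ := by
  have hbind := hP.2 μ hμ
  have hmeas : AEMeasurable (fun s => (P (κ s)).map (prep s)) μ := by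
    by_contra h
    have := hP.1 μ hμ
    have h0 : P μ = 0 := by
      rw [hbind, Measure.bind, Measure.map_of_not_aemeasurable h, Measure.join_zero]
    exact IsProbabilityMeasure.ne_zero (P μ) h0
  rw [hbind, Measure.bind_apply hE hmeas]
  exact lintegral_congr fun s => Measure.map_apply (measurable_prep s) hE

theorem measurableSet_exists_ge_mem {S : Type*} [MeasurableSpace S] {A : Set S}
    (hA : MeasurableSet A) (n : ℕ) : MeasurableSet {ρ : ℕ → S | ∃ j ≥ n, ρ j ∈ A} := by
  have : {ρ : ℕ → S | ∃ j ≥ n, ρ j ∈ A} = ⋃ j ≥ n, (fun ρ : ℕ → S => ρ j) ⁻¹' A := by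
    ext ρ; simp
  rw [this]
  exact .iUnion fun j => .iUnion fun _ => measurable_pi_apply j hA

theorem preimage_prep_exists_ge_mem {S : Type*} (s : S) (A : Set S) (n : ℕ) :
    prep s ⁻¹' {ρ | ∃ j ≥ n + 1, ρ j ∈ A} = {ρ | ∃ j ≥ n, ρ j ∈ A} := by
  ext ρ
  constructor
  · rintro ⟨_ | j, hj, h⟩
    · omega
    · exact ⟨j, by omega, h⟩
  · rintro ⟨j, hj, h⟩
    exact ⟨j + 1, by omega, h⟩

/-- An attractor is almost surely visited after any given time. -/
theorem attractor_visited_after {S : Type*} [MeasurableSpace S] {κ : Kernel S S}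
    [IsMarkovKernel κ] {P : Measure S → Measure (ℕ → S)} (hP : IsPathMeasure κ P)
    {A : Set S} (hA : MeasurableSet A)
    (hattr : ∀ μ : Measure S, IsProbabilityMeasure μ → P μ (FEv A) = 1) (n : ℕ)
    (μ : Measure S) [hμ : IsProbabilityMeasure μ] : P μ {ρ | ∃ j ≥ n, ρ j ∈ A} = 1 := by
  induction n generalizing μ with
  | zero => simpa [FEv] using hattr μ hμ
  | succ n ih =>
    rw [hP.apply_eq_lintegral_s11 μ (measurableSet_exists_ge_mem hA (n + 1))]
    simp only [preimage_prep_exists_ge_mem, ih, lintegral_const, measure_univ, mul_one]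

/-- An attractor is almost surely visited infinitely often: if `A` is an attractor,
then for every initial distribution `μ`, `P_μ(GF A) = 1`. -/
theorem attractor_visited_infinitely_often
    {S : Type*} [MeasurableSpace S] (κ : Kernel S S) [IsMarkovKernel κ]
    (P : Measure S → Measure (ℕ → S)) (hP : IsPathMeasure κ P)
    (A : Set S) (hA : MeasurableSet A)
    (hattr : ∀ μ : Measure S, IsProbabilityMeasure μ → P μ (FEv A) = 1) :
    ∀ μ : Measure S, IsProbabilityMeasure μ → P μ (GFEv A) = 1 := by
  intro μ hμ
  have := hP.1 μ hμ
  have hset : GFEv A = ⋂ i, {ρ : ℕ → S | ∃ j ≥ i, ρ j ∈ A} := by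
    ext ρ; simp [GFEv]
  rw [hset, ← prob_compl_eq_zero_iff
    (MeasurableSet.iInter fun i => measurableSet_exists_ge_mem hA i), compl_iInter,
    measure_iUnion_null_iff]
  intro i
  rw [prob_compl_eq_zero_iff (measurableSet_exists_ge_mem hA i)]
  exact attractor_visited_after hP hA hattr i μ
end
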